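/- Let ρ be a density matrix on ℂ^d, let U be a unitary d×d complex matrix, and set ρ' = U ρ U†. Then Tr(ρ²) = ∑_{b,b'} |ρ'_{b b'}|², and consequently the VQSD cost function C = Tr(ρ²) − ∑_b |ρ'_{bb}|² satisfies C ≥ 0, with C = 0 if and only if ρ' is diagonal (i.e., ρ'_{b b'} = 0 for all b ≠ b'). -/

import Mathlib

open Matrix BigOperators
open scoped ComplexOrder

theorem Matrix.IsHermitian.trace_mul_self_eq_sum_norm_sq {n : Type*} [Fintype n]
    {A : Matrix n n ℂ} (hA : A.IsHermitian) :
    (A * A).trace = ((∑ i, ∑ j, ‖A i j‖ ^ 2 : ℝ) : ℂ) := by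
  simp only [Matrix.trace, Matrix.diag_apply, Matrix.mul_apply]
  push_cast
  refine Finset.sum_congr rfl fun i _ => Finset.sum_congr rfl fun j _ => ?_
  rw [← hA.apply j i]
  exact Complex.mul_conj' (A i j)

theorem Matrix.trace_unitary_conj_mul_self {n : Type*} [Fintype n] [DecidableEq n]
    (A : Matrix n n ℂ) {U : Matrix n n ℂ} (hU : U ∈ Matrix.unitaryGroup n ℂ) :
    ((U * A * Uᴴ) * (U * A * Uᴴ)).trace = (A * A).trace := by
  have hUU : Uᴴ * U = 1 := Matrix.mem_unitaryGroup_iff'.mp hU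
  calc ((U * A * Uᴴ) * (U * A * Uᴴ)).trace
      = (U * (A * (Uᴴ * U) * A) * Uᴴ).trace := by simp only [Matrix.mul_assoc]
    _ = (A * A).trace := by
      rw [Matrix.trace_mul_comm, ← Matrix.mul_assoc, hUU, Matrix.one_mul, Matrix.mul_one]

theorem Finset.sum_sum_sub_sum_diag {n : Type*} [Fintype n] [DecidableEq n] (f : n → n → ℝ) :
    ∑ i, ∑ j, f i j - ∑ i, f i i = ∑ i, ∑ j ∈ Finset.univ.erase i, f i j := by
  rw [← Finset.sum_sub_distrib]
  refine Finset.sum_congr rfl fun i _ => ?_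
  rw [← Finset.add_sum_erase _ _ (Finset.mem_univ i), add_sub_cancel_left]

/-- For a density matrix `ρ` on `ℂ^d` and a unitary `U`, with `ρ' = U ρ U†`, we have
`Tr(ρ²) = ∑_{b,b'} |ρ'_{b b'}|²`; consequently the VQSD cost function
`C = Tr(ρ²) − ∑_b |ρ'_{bb}|²` is nonnegative, and vanishes iff `ρ'` is diagonal. -/
theorem vqsd_cost_nonneg_and_faithful {d : ℕ}
    (ρ U ρ' : Matrix (Fin d) (Fin d) ℂ)
    (hρ_psd : ρ.PosSemidef) (hρ_tr : ρ.trace = 1)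
    (hU : U ∈ Matrix.unitaryGroup (Fin d) ℂ)
    (hρ' : ρ' = U * ρ * Uᴴ) :
    (ρ * ρ).trace = ((∑ b : Fin d, ∑ b' : Fin d, ‖ρ' b b'‖ ^ 2 : ℝ) : ℂ) ∧
    0 ≤ ((ρ * ρ).trace).re - ∑ b : Fin d, ‖ρ' b b‖ ^ 2 ∧
    (((ρ * ρ).trace).re - ∑ b : Fin d, ‖ρ' b b‖ ^ 2 = 0 ↔
      ∀ b b' : Fin d, b ≠ b' → ρ' b b' = 0) := by
  have htrace : (ρ * ρ).trace = ((∑ b : Fin d, ∑ b' : Fin d, ‖ρ' b b'‖ ^ 2 : ℝ) : ℂ) := by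
    have hherm : ρ'.IsHermitian :=
      hρ' ▸ Matrix.isHermitian_mul_mul_conjTranspose U hρ_psd.isHermitian
    rw [← hherm.trace_mul_self_eq_sum_norm_sq, hρ', Matrix.trace_unitary_conj_mul_self ρ hU]
  have hnonneg : ∀ b : Fin d, 0 ≤ ∑ b' ∈ Finset.univ.erase b, ‖ρ' b b'‖ ^ 2 :=
    fun b => Finset.sum_nonneg fun _ _ => sq_nonneg _
  refine ⟨htrace, ?_⟩
  rw [htrace, Complex.ofReal_re, Finset.sum_sum_sub_sum_diag fun b b' => ‖ρ' b b'‖ ^ 2]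
  refine ⟨Finset.sum_nonneg fun b _ => hnonneg b, ?_⟩
  rw [Finset.sum_eq_zero_iff_of_nonneg fun b _ => hnonneg b]
  refine ⟨fun h b b' hbb' => ?_, fun h b _ => Finset.sum_eq_zero fun b' hb' => ?_⟩
  · have hsq := (Finset.sum_eq_zero_iff_of_nonneg fun _ _ => sq_nonneg _).mp
      (h b (Finset.mem_univ b)) b' (Finset.mem_erase.mpr ⟨hbb'.symm, Finset.mem_univ b'⟩)
    exact norm_eq_zero.mp (pow_eq_zero_iff two_ne_zero |>.mp hsq)
  · simp [h b b' (Finset.ne_of_mem_erase hb').symm]
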